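/- arXiv:1301.0669 — 7 statements merged into one kernel-verified Lean document; each statement's English description precedes it below -/
import Mathlib

section
/- Let p be an odd prime, R = F_p + vF_p with v^2 = v, θ = λ + vμ a unit of R (λ, μ ∈ F_p), and let C = vC_{1−v} ⊕ (1−v)C_v be a linear code of length n over R. Then C is a θ-constacyclic code of length n over R if and only if C_v is a λ-constacyclic code and C_{1−v} is a (λ+μ)-constacyclic code of length n over F_p. -/
open Polynomial

/-- The ring `R = F_p + vF_p` with `v² = v` is modeled as `F_p × F_p`, where the
idempotent `v` corresponds to `(0, 1)`. -/
def vR (p : ℕ) : ZMod p × ZMod p := (0, 1)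

/-- The natural embedding `F_p → R = F_p + vF_p`. -/
def ofFHom (p : ℕ) : ZMod p →+* ZMod p × ZMod p :=
  RingHom.prod (RingHom.id _) (RingHom.id _)

/-- The vector `v·a + (1-v)·b ∈ R^n` attached to `a, b ∈ F_p^n` (coordinatewise). -/
def mix {p : ℕ} {n : ℕ} (a b : Fin n → ZMod p) : Fin n → ZMod p × ZMod p :=
  fun i => vR p * ofFHom p (a i) + (1 - vR p) * ofFHom p (b i)

/-- `C_v = {b ∈ F_p^n : ∃ a ∈ F_p^n, v·a + (1-v)·b ∈ C}`. -/
def CvSet {p n : ℕ} (C : Set (Fin n → ZMod p × ZMod p)) : Set (Fin n → ZMod p) :=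
  {b | ∃ a, mix a b ∈ C}

/-- `C_{1-v} = {a ∈ F_p^n : ∃ b ∈ F_p^n, v·a + (1-v)·b ∈ C}`. -/
def C1vSet {p n : ℕ} (C : Set (Fin n → ZMod p × ZMod p)) : Set (Fin n → ZMod p) :=
  {a | ∃ b, mix a b ∈ C}

/-- The `θ`-constacyclic shift `(c_0, …, c_{n-1}) ↦ (θ·c_{n-1}, c_0, …, c_{n-2})`. -/
def shift {m : ℕ} {S : Type*} [Mul S] (θ : S) (c : Fin m → S) : Fin m → S :=
  fun i =>
    if h : (i : ℕ) = 0 then θ * c ⟨m - 1, by have := i.isLt; omega⟩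
    else c ⟨(i : ℕ) - 1, by have := i.isLt; omega⟩

/-- A set of words is `θ`-constacyclic when it is closed under the `θ`-constacyclic shift. -/
def IsConstacyclic {m : ℕ} {S : Type*} [Mul S] (θ : S) (C : Set (Fin m → S)) : Prop :=
  ∀ c ∈ C, shift θ c ∈ C

theorem mix_apply {p n : ℕ} (a b : Fin n → ZMod p) (i : Fin n) : mix a b i = (b i, a i) := by
  ext <;> simp [mix, vR, ofFHom]

theorem mix_snd_fst {p n : ℕ} (c : Fin n → ZMod p × ZMod p) :
    mix (fun i => (c i).2) (fun i => (c i).1) = c :=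
  funext fun i => mix_apply _ _ i

theorem shift_mix {p n : ℕ} (lam mu : ZMod p) (a b : Fin n → ZMod p) :
    shift (ofFHom p lam + vR p * ofFHom p mu) (mix a b) =
      mix (shift (lam + mu) a) (shift lam b) := by
  funext i
  rw [mix_apply]
  by_cases h : (i : ℕ) = 0
  · ext <;> simp [shift, h, mix_apply, vR, ofFHom]
  · simp [shift, h, mix_apply]

/-- A linear code over `R` contains every word glued from its two components. -/
theorem mix_mem_of_mix_mem {p n : ℕ}
    {C : Submodule (ZMod p × ZMod p) (Fin n → ZMod p × ZMod p)} {a a' b b' : Fin n → ZMod p}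
    (h : mix a b ∈ C) (h' : mix a' b' ∈ C) : mix a b' ∈ C := by
  have key : mix a b' = vR p • mix a b + (1 - vR p) • mix a' b' := by
    funext i
    ext <;> simp [mix_apply, vR]
  rw [key]
  exact C.add_mem (C.smul_mem _ h) (C.smul_mem _ h')

/-- **Theorem 1.** Let `p` be an odd prime, `R = F_p + vF_p` with `v² = v`,
`θ = λ + vμ` a unit of `R`, and `C = vC_{1-v} ⊕ (1-v)C_v` a linear code of length `n`
over `R`.  Then `C` is `θ`-constacyclic over `R` iff `C_v` is `λ`-constacyclic and
`C_{1-v}` is `(λ+μ)`-constacyclic over `F_p`. -/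
theorem constacyclic_iff (p n : ℕ) (hp : p.Prime) (hodd : Odd p) (lam mu : ZMod p)
    (hθ : IsUnit (ofFHom p lam + vR p * ofFHom p mu))
    (C : Submodule (ZMod p × ZMod p) (Fin n → ZMod p × ZMod p)) :
    IsConstacyclic (ofFHom p lam + vR p * ofFHom p mu) (C : Set (Fin n → ZMod p × ZMod p)) ↔
      IsConstacyclic lam (CvSet (C : Set (Fin n → ZMod p × ZMod p))) ∧
        IsConstacyclic (lam + mu) (C1vSet (C : Set (Fin n → ZMod p × ZMod p))) := by
  constructor
  · intro hC
    refine ⟨?_, ?_⟩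
    · rintro b ⟨a, hab⟩
      exact ⟨shift (lam + mu) a, shift_mix lam mu a b ▸ hC _ hab⟩
    · rintro a ⟨b, hab⟩
      exact ⟨shift lam b, shift_mix lam mu a b ▸ hC _ hab⟩
  · rintro ⟨hb, ha⟩ c hc
    rw [← mix_snd_fst c] at hc ⊢
    rw [shift_mix]
    obtain ⟨_, h⟩ := ha _ ⟨_, hc⟩
    obtain ⟨_, h'⟩ := hb _ ⟨_, hc⟩
    exact mix_mem_of_mix_mem h h'
end

section
/- Let p be an odd prime, R = F_p + vF_p with v^2 = v, θ = λ + vμ a unit of R, and let C = vC_{1−v} ⊕ (1−v)C_v be a θ-constacyclic code of length n over R, viewed as an ideal of R_n = R[x]/⟨x^n − θ⟩. If g_{1−v}(x) and g_v(x) are the (monic) generator polynomials of the (λ+μ)-constacyclic code C_{1−v} ⊆ F_p[x]/⟨x^n − (λ+μ)⟩ and of the λ-constacyclic code C_v ⊆ F_p[x]/⟨x^n − λ⟩ respectively, then C = ⟨v·g_{1−v}(x), (1−v)·g_v(x)⟩ as an ideal of R_n. -/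
open Polynomial

/-- `C_v`: image of the ideal `C ⊆ R[x]/⟨x^n - θ⟩` in `F_p[x]/⟨x^n - λ⟩`, via the
projection `τ : R → F_p`, `v·a + (1-v)·b ↦ b` (first coordinate). -/
noncomputable def CvIdeal (p n : ℕ) (θ : ZMod p × ZMod p) (lam : ZMod p)
    (C : Ideal ((ZMod p × ZMod p)[X] ⧸
      Ideal.span {(X : (ZMod p × ZMod p)[X]) ^ n - Polynomial.C θ})) :
    Ideal ((ZMod p)[X] ⧸ Ideal.span {(X : (ZMod p)[X]) ^ n - Polynomial.C lam}) :=
  Ideal.map ((Ideal.Quotient.mk (Ideal.span {(X : (ZMod p)[X]) ^ n - Polynomial.C lam})).comp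
      (mapRingHom (RingHom.fst (ZMod p) (ZMod p))))
    (Ideal.comap (Ideal.Quotient.mk
      (Ideal.span {(X : (ZMod p × ZMod p)[X]) ^ n - Polynomial.C θ})) C)

/-- `C_{1-v}`: image of the ideal `C ⊆ R[x]/⟨x^n - θ⟩` in `F_p[x]/⟨x^n - (λ+μ)⟩`, via the
projection `σ : R → F_p`, `v·a + (1-v)·b ↦ a` (second coordinate). -/
noncomputable def C1vIdeal (p n : ℕ) (θ : ZMod p × ZMod p) (lammu : ZMod p)
    (C : Ideal ((ZMod p × ZMod p)[X] ⧸
      Ideal.span {(X : (ZMod p × ZMod p)[X]) ^ n - Polynomial.C θ})) :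
    Ideal ((ZMod p)[X] ⧸ Ideal.span {(X : (ZMod p)[X]) ^ n - Polynomial.C lammu}) :=
  Ideal.map ((Ideal.Quotient.mk (Ideal.span {(X : (ZMod p)[X]) ^ n - Polynomial.C lammu})).comp
      (mapRingHom (RingHom.snd (ZMod p) (ZMod p))))
    (Ideal.comap (Ideal.Quotient.mk
      (Ideal.span {(X : (ZMod p × ZMod p)[X]) ^ n - Polynomial.C θ})) C)

section Component

variable {A B : Type*} [CommRing A] [CommRing B]

/-- An ideal containing `h` is recovered from its image modulo `h` when that image is generated
by the class of a divisor of `h`. -/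
lemma eq_span_of_map_mk_eq_span {I : Ideal B} {g h : B} (hI : h ∈ I) (hgh : g ∣ h)
    (hmap : I.map (Ideal.Quotient.mk (Ideal.span {h})) =
      Ideal.span {Ideal.Quotient.mk (Ideal.span {h}) g}) :
    I = Ideal.span {g} := by
  have key := congrArg (Ideal.comap (Ideal.Quotient.mk (Ideal.span {h}))) hmap
  rw [← Set.image_singleton, ← Ideal.map_span,
    Ideal.comap_map_of_surjective' _ Ideal.Quotient.mk_surjective,
    Ideal.comap_map_of_surjective' _ Ideal.Quotient.mk_surjective, Ideal.mk_ker,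
    sup_eq_left.2 ((Ideal.span_singleton_le_iff_mem I).2 hI),
    sup_eq_left.2 (Ideal.span_singleton_le_span_singleton.2 hgh)] at key
  exact key

variable {φ : A →+* B} {ι : B →+* A} {e : A} {D : Ideal A} {g : B}

lemma mul_section_mem (hφ : Function.Surjective φ) (he : ∀ a, e * ι (φ a) = e * a)
    (hD : D.map φ = Ideal.span {g}) : e * ι g ∈ D := by
  obtain ⟨d, hd, rfl⟩ := (Ideal.mem_map_iff_of_surjective φ hφ).1
    (hD ▸ Ideal.mem_span_singleton_self g)
  exact he d ▸ D.mul_mem_left e hd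

lemma mul_section_dvd (he : ∀ a, e * ι (φ a) = e * a) (hD : D.map φ = Ideal.span {g})
    {d : A} (hd : d ∈ D) : e * ι g ∣ e * d := by
  obtain ⟨c, hc⟩ := Ideal.mem_span_singleton.1 (hD ▸ Ideal.mem_map_of_mem φ hd)
  exact ⟨ι c, by rw [← he, hc, map_mul, mul_assoc]⟩

end Component

lemma C_vR_mul_map_snd (p : ℕ) (a : (ZMod p × ZMod p)[X]) :
    C (vR p) * mapRingHom (ofFHom p) (mapRingHom (RingHom.snd (ZMod p) (ZMod p)) a) =
      C (vR p) * a := by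
  ext i <;> simp [vR, ofFHom]

lemma one_sub_C_vR_mul_map_fst (p : ℕ) (a : (ZMod p × ZMod p)[X]) :
    (1 - C (vR p)) * mapRingHom (ofFHom p) (mapRingHom (RingHom.fst (ZMod p) (ZMod p)) a) =
      (1 - C (vR p)) * a := by
  ext i <;> simp [vR, ofFHom, sub_mul]

/-- **Theorem 2.** Let `p` be an odd prime, `R = F_p + vF_p` with `v² = v`,
`θ = λ + vμ` a unit of `R`, and `C = vC_{1-v} ⊕ (1-v)C_v` a `θ`-constacyclic code of
length `n` over `R`, viewed as an ideal of `R_n = R[x]/⟨x^n - θ⟩`.  If `g_{1-v}(x)` and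
`g_v(x)` are the monic generator polynomials of `C_{1-v}` and `C_v` respectively, then
`C = ⟨v·g_{1-v}(x), (1-v)·g_v(x)⟩`. -/
theorem code_eq_span_of_generators (p n : ℕ) (hp : p.Prime) (hodd : Odd p) (hn : 0 < n)
    (lam mu : ZMod p) (hθ : IsUnit (ofFHom p lam + vR p * ofFHom p mu))
    (C : Ideal ((ZMod p × ZMod p)[X] ⧸
      Ideal.span {(X : (ZMod p × ZMod p)[X]) ^ n -
        Polynomial.C (ofFHom p lam + vR p * ofFHom p mu)}))
    (g1v gv : (ZMod p)[X])
    (hg1v_monic : g1v.Monic) (hg1v_dvd : g1v ∣ (X : (ZMod p)[X]) ^ n - Polynomial.C (lam + mu))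
    (hg1v : C1vIdeal p n (ofFHom p lam + vR p * ofFHom p mu) (lam + mu) C =
      Ideal.span {Ideal.Quotient.mk
        (Ideal.span {(X : (ZMod p)[X]) ^ n - Polynomial.C (lam + mu)}) g1v})
    (hgv_monic : gv.Monic) (hgv_dvd : gv ∣ (X : (ZMod p)[X]) ^ n - Polynomial.C lam)
    (hgv : CvIdeal p n (ofFHom p lam + vR p * ofFHom p mu) lam C =
      Ideal.span {Ideal.Quotient.mk
        (Ideal.span {(X : (ZMod p)[X]) ^ n - Polynomial.C lam}) gv}) :
    C = Ideal.span
      {Ideal.Quotient.mk _ (Polynomial.C (vR p) * g1v.map (ofFHom p)),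
       Ideal.Quotient.mk _ ((1 - Polynomial.C (vR p)) * gv.map (ofFHom p))} := by
  set π := Ideal.Quotient.mk (Ideal.span {(X : (ZMod p × ZMod p)[X]) ^ n -
    Polynomial.C (ofFHom p lam + vR p * ofFHom p mu)}) with hπ
  have hmem : (X : (ZMod p × ZMod p)[X]) ^ n -
      Polynomial.C (ofFHom p lam + vR p * ofFHom p mu) ∈ C.comap π := by
    rw [Ideal.mem_comap, hπ, Ideal.Quotient.eq_zero_iff_mem.2 (Ideal.mem_span_singleton_self _)]
    exact C.zero_mem
  have hsnd : (C.comap π).map (mapRingHom (RingHom.snd (ZMod p) (ZMod p))) =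
      Ideal.span {g1v} := by
    refine eq_span_of_map_mk_eq_span ?_ hg1v_dvd (by rw [Ideal.map_map]; exact hg1v)
    simpa [ofFHom, vR] using
      Ideal.mem_map_of_mem (mapRingHom (RingHom.snd (ZMod p) (ZMod p))) hmem
  have hfst : (C.comap π).map (mapRingHom (RingHom.fst (ZMod p) (ZMod p))) =
      Ideal.span {gv} := by
    refine eq_span_of_map_mk_eq_span ?_ hgv_dvd (by rw [Ideal.map_map]; exact hgv)
    simpa [ofFHom, vR] using
      Ideal.mem_map_of_mem (mapRingHom (RingHom.fst (ZMod p) (ZMod p))) hmem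
  apply le_antisymm
  · intro x hx
    obtain ⟨d, rfl⟩ := Ideal.Quotient.mk_surjective x
    obtain ⟨a, ha⟩ := mul_section_dvd (C_vR_mul_map_snd p) hsnd (d := d) hx
    obtain ⟨b, hb⟩ := mul_section_dvd (one_sub_C_vR_mul_map_fst p) hfst (d := d) hx
    refine Ideal.mem_span_pair.2 ⟨π a, π b, ?_⟩
    rw [← map_mul, ← map_mul, ← map_add]
    congr 1
    simp only [coe_mapRingHom] at ha hb
    linear_combination -ha - hb
  · rw [Ideal.span_le, Set.pair_subset_iff]
    exact ⟨mul_section_mem (map_surjective _ Prod.snd_surjective) (C_vR_mul_map_snd p) hsnd,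
      mul_section_mem (map_surjective _ Prod.fst_surjective) (one_sub_C_vR_mul_map_fst p) hfst⟩
end

section
/- Let p be an odd prime, R = F_p + vF_p with v^2 = v, θ = λ + vμ a unit of R, and C = vC_{1−v} ⊕ (1−v)C_v a θ-constacyclic code of length n over R, viewed as an ideal of R_n = R[x]/⟨x^n − θ⟩. Suppose C = ⟨v·h_1(x), (1−v)·h_2(x)⟩ where h_1(x), h_2(x) ∈ F_p[x] are monic with h_1(x) | (x^n − (λ+μ)) and h_2(x) | (x^n − λ). Then C_{1−v} is the ideal of F_p[x]/⟨x^n − (λ+μ)⟩ generated by h_1(x), and C_v is the ideal of F_p[x]/⟨x^n − λ⟩ generated by h_2(x); that is, h_1(x) and h_2(x) are the generator polynomials of C_{1−v} and C_v respectively. -/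
open Polynomial

/-- If `φ` sends the ideal `I` into the kernel of the projection to `B ⧸ J`, then pulling back an
ideal of `A ⧸ I` spanned by two classes and pushing it forward along `φ` gives the ideal spanned by
the images of the two representatives. -/
theorem map_comap_mk_span_pair {A B : Type*} [CommRing A] [CommRing B] (I : Ideal A) (J : Ideal B)
    (φ : A →+* B) (h : I.map φ ≤ J) (a b : A) :
    Ideal.map ((Ideal.Quotient.mk J).comp φ) (Ideal.comap (Ideal.Quotient.mk I)
      (Ideal.span {Ideal.Quotient.mk I a, Ideal.Quotient.mk I b})) =
    Ideal.span {Ideal.Quotient.mk J (φ a), Ideal.Quotient.mk J (φ b)} := by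
  have hspan : Ideal.span {Ideal.Quotient.mk I a, Ideal.Quotient.mk I b} =
      (Ideal.span {a, b}).map (Ideal.Quotient.mk I) := by
    rw [Ideal.map_span, Set.image_pair]
  have hker : I.map ((Ideal.Quotient.mk J).comp φ) = ⊥ := by
    rw [← Ideal.map_map, eq_bot_iff]
    exact (Ideal.map_mono h).trans (Ideal.map_quotient_self J).le
  rw [hspan, Ideal.comap_map_of_surjective _ Ideal.Quotient.mk_surjective, ← RingHom.ker_eq_comap_bot,
    Ideal.mk_ker, Ideal.map_sup, hker, sup_bot_eq, Ideal.map_span, Set.image_pair]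
  rfl

/-- **Theorem 3.** Let `p` be an odd prime, `R = F_p + vF_p` with `v² = v`,
`θ = λ + vμ` a unit of `R`, and `C = vC_{1-v} ⊕ (1-v)C_v` a `θ`-constacyclic code of
length `n` over `R`, viewed as an ideal of `R_n = R[x]/⟨x^n - θ⟩`.  If
`C = ⟨v·h₁(x), (1-v)·h₂(x)⟩` with `h₁, h₂ ∈ F_p[x]` monic, `h₁ ∣ x^n - (λ+μ)` and
`h₂ ∣ x^n - λ`, then `C_{1-v} = [h₁(x)]` and `C_v = [h₂(x)]`, i.e. `h₁` and `h₂` are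
the generator polynomials of `C_{1-v}` and `C_v`. -/
theorem generators_of_span (p n : ℕ) (hp : p.Prime) (hodd : Odd p) (hn : 0 < n)
    (lam mu : ZMod p) (hθ : IsUnit (ofFHom p lam + vR p * ofFHom p mu))
    (C : Ideal ((ZMod p × ZMod p)[X] ⧸
      Ideal.span {(X : (ZMod p × ZMod p)[X]) ^ n -
        Polynomial.C (ofFHom p lam + vR p * ofFHom p mu)}))
    (h1 h2 : (ZMod p)[X])
    (hh1_monic : h1.Monic) (hh1_dvd : h1 ∣ (X : (ZMod p)[X]) ^ n - Polynomial.C (lam + mu))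
    (hh2_monic : h2.Monic) (hh2_dvd : h2 ∣ (X : (ZMod p)[X]) ^ n - Polynomial.C lam)
    (hC : C = Ideal.span
      {Ideal.Quotient.mk _ (Polynomial.C (vR p) * h1.map (ofFHom p)),
       Ideal.Quotient.mk _ ((1 - Polynomial.C (vR p)) * h2.map (ofFHom p))}) :
    C1vIdeal p n (ofFHom p lam + vR p * ofFHom p mu) (lam + mu) C =
      Ideal.span {Ideal.Quotient.mk
        (Ideal.span {(X : (ZMod p)[X]) ^ n - Polynomial.C (lam + mu)}) h1} ∧
    CvIdeal p n (ofFHom p lam + vR p * ofFHom p mu) lam C =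
      Ideal.span {Ideal.Quotient.mk
        (Ideal.span {(X : (ZMod p)[X]) ^ n - Polynomial.C lam}) h2} := by
  have hfst : (RingHom.fst (ZMod p) (ZMod p)).comp (ofFHom p) = RingHom.id _ :=
    RingHom.ext fun _ => rfl
  have hsnd : (RingHom.snd (ZMod p) (ZMod p)).comp (ofFHom p) = RingHom.id _ :=
    RingHom.ext fun _ => rfl
  subst hC
  constructor
  · rw [C1vIdeal, map_comap_mk_span_pair]
    · simp [Polynomial.map_map, hsnd, vR, Ideal.span_pair_zero]
    · rw [Ideal.map_span, Set.image_singleton]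
      simp [vR, ofFHom]
  · rw [CvIdeal, map_comap_mk_span_pair]
    · simp [Polynomial.map_map, hfst, vR]
    · rw [Ideal.map_span, Set.image_singleton]
      simp [vR, ofFHom]
end

section
/- Let p be an odd prime, R = F_p + vF_p with v^2 = v, and ϑ = 1 − 2v or ϑ = −1 + 2v. Define the Gray map φ_ϑ : R^n → F_p^{2n} by sending (c_0,…,c_{n−1}) with c_i = r_i + v·q_i (r_i, q_i ∈ F_p) to (λ(λ+μ)q_0, …, λ(λ+μ)q_{n−1}, −μr_0 − (λ+μ)q_0, …, −μr_{n−1} − (λ+μ)q_{n−1}), where ϑ = λ + vμ. Let α : R^n → R^n be the ϑ-constacyclic shift α(c_0,…,c_{n−1}) = (ϑc_{n−1}, c_0,…,c_{n−2}) and β : F_p^{2n} → F_p^{2n} the cyclic shift β(d_0,…,d_{2n−1}) = (d_{2n−1}, d_0,…,d_{2n−2}). Then φ_ϑ ∘ α = β ∘ φ_ϑ. -/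
open Polynomial

/-- The Gray map `φ_ϑ : R^n → F_p^{2n}` attached to `ϑ = λ + vμ`: writing
`c_i = r_i + v·q_i` (so `r_i = τ(c_i)` and `q_i = σ(c_i) - τ(c_i)`), it sends
`(c_0, …, c_{n-1})` to
`(λ(λ+μ)q_0, …, λ(λ+μ)q_{n-1}, -μr_0 - (λ+μ)q_0, …, -μr_{n-1} - (λ+μ)q_{n-1})`. -/
def grayVec (p n : ℕ) (lam mu : ZMod p) (c : Fin n → ZMod p × ZMod p) :
    Fin (2 * n) → ZMod p :=
  fun j =>
    if h : (j : ℕ) < n then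
      lam * (lam + mu) * ((c ⟨j, h⟩).2 - (c ⟨j, h⟩).1)
    else
      -mu * (c ⟨(j : ℕ) - n, by have := j.isLt; omega⟩).1 -
        (lam + mu) * ((c ⟨(j : ℕ) - n, by have := j.isLt; omega⟩).2 -
          (c ⟨(j : ℕ) - n, by have := j.isLt; omega⟩).1)

/-- **Lemma 2.** Let `p` be an odd prime, `R = F_p + vF_p` with `v² = v`,
and `ϑ = 1 - 2v` or `ϑ = -1 + 2v`, written `ϑ = λ + vμ`.  Let `α` be the
`ϑ`-constacyclic shift of `R^n` and `β` the cyclic shift of `F_p^{2n}`.  Then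
`φ_ϑ ∘ α = β ∘ φ_ϑ`. -/
theorem gray_shift_comm (p n : ℕ) (hp : p.Prime) (hodd : Odd p)
    (lam mu : ZMod p) (hϑ : (lam = 1 ∧ mu = -2) ∨ (lam = -1 ∧ mu = 2)) :
    (grayVec p n lam mu) ∘ (shift (ofFHom p lam + vR p * ofFHom p mu)) =
      (shift (1 : ZMod p)) ∘ (grayVec p n lam mu) := by
  have hprod : lam * (lam + mu) = -1 := by rcases hϑ with ⟨rfl, rfl⟩ | ⟨rfl, rfl⟩ <;> ring
  have hmu : mu = -2 * lam := by rcases hϑ with ⟨rfl, rfl⟩ | ⟨rfl, rfl⟩ <;> ring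
  funext c ⟨j, hj⟩
  have hn : 0 < n := by omega
  have hlast : ¬ 2 * n - 1 < n := by omega
  have hidx : 2 * n - 1 - n = n - 1 := by omega
  rcases Nat.eq_zero_or_pos j with rfl | hj0
  · simp only [Function.comp_apply, grayVec, shift, hn, hlast, hidx, ofFHom, vR, dite_true,
      dite_false, hprod]
    simp
    ring
  rcases lt_trichotomy j n with h | rfl | h
  · have h' : j - 1 < n := by omega
    simp [grayVec, shift, hj0.ne', h, h']
  · have h' : j - 1 < j := by omega
    simp only [Function.comp_apply, grayVec, shift, hj0.ne', h', lt_irrefl, Nat.sub_self,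
      ofFHom, vR, dite_true, dite_false]
    simp
    linear_combination (lam * (c ⟨j - 1, h'⟩).1 - (lam + mu) * (c ⟨j - 1, h'⟩).2) * hmu
  · have h₁ : ¬ j < n := by omega
    have h₂ : ¬ j - 1 < n := by omega
    have h₃ : j - n ≠ 0 := by omega
    have h₄ : j - n - 1 = j - 1 - n := by omega
    simp only [Function.comp_apply, grayVec, shift, hj0.ne', h₁, h₂, h₃, h₄, dite_false]
end

section
/- Let p be an odd prime, R = F_p + vF_p with v^2 = v, and ϑ = 1 − 2v or ϑ = −1 + 2v, written as ϑ = λ + vμ. Let φ_ϑ : R^n → F_p^{2n} be the Gray map sending (c_0,…,c_{n−1}) with c_i = r_i + v·q_i to (λ(λ+μ)q_0, …, λ(λ+μ)q_{n−1}, −μr_0 − (λ+μ)q_0, …, −μr_{n−1} − (λ+μ)q_{n−1}). A linear code C of length n over R is a ϑ-constacyclic code if and only if φ_ϑ(C) is a cyclic code of length 2n over F_p (i.e., an F_p-subspace of F_p^{2n} closed under the cyclic shift). -/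
open Polynomial

/-- The Gray map intertwines the constacyclic shift with the cyclic shift. -/
theorem grayVec_shift (p n : ℕ) (lam mu : ZMod p) (hsq : lam * lam = 1) (hmu : mu = -2 * lam)
    (c : Fin n → ZMod p × ZMod p) :
    grayVec p n lam mu (shift (ofFHom p lam + vR p * ofFHom p mu) c) =
      shift 1 (grayVec p n lam mu c) := by
  subst hmu
  funext ⟨j, hj⟩
  rcases Nat.eq_zero_or_pos j with rfl | hj0
  · have hn : 0 < n := by omega
    have h1 : ¬ 2 * n - 1 < n := by omega
    have h2 : 2 * n - 1 - n = n - 1 := by omega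
    simp only [grayVec, shift, hn, h1, h2, dite_true, dite_false, ofFHom, vR, RingHom.prod_apply,
      RingHom.id_apply, Prod.fst_add, Prod.snd_add, Prod.fst_mul, Prod.snd_mul]
    linear_combination lam * ((c ⟨n - 1, by omega⟩).1 + (c ⟨n - 1, by omega⟩).2) * hsq
  · rcases lt_trichotomy j n with h | rfl | h
    · have h1 : j - 1 < n := by omega
      simp [grayVec, shift, h, h1, hj0.ne']
    · have h1 : j - 1 < j := by omega
      simp only [grayVec, shift, hj0.ne', h1, lt_irrefl, Nat.sub_self, dite_true, dite_false,
        ofFHom, vR, RingHom.prod_apply, RingHom.id_apply, Prod.fst_add, Prod.snd_add,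
        Prod.fst_mul, Prod.snd_mul]
      ring
    · have h1 : ¬ j < n := by omega
      have h2 : ¬ j - 1 < n := by omega
      have h3 : j - n ≠ 0 := by omega
      have h4 : j - 1 - n = j - n - 1 := by omega
      simp [grayVec, shift, h1, h2, h3, h4, hj0.ne']

theorem grayVec_add (p n : ℕ) (lam mu : ZMod p) (c d : Fin n → ZMod p × ZMod p) :
    grayVec p n lam mu (c + d) = grayVec p n lam mu c + grayVec p n lam mu d := by
  funext j
  by_cases h : (j : ℕ) < n <;> simp [grayVec, h] <;> ring

theorem grayVec_smul (p n : ℕ) (lam mu a : ZMod p) (c : Fin n → ZMod p × ZMod p) :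
    grayVec p n lam mu (ofFHom p a • c) = a • grayVec p n lam mu c := by
  funext j
  by_cases h : (j : ℕ) < n <;> simp [grayVec, ofFHom, h] <;> ring

theorem grayVec_injective (p n : ℕ) [Fact p.Prime] (h2 : (2 : ZMod p) ≠ 0) (lam mu : ZMod p)
    (hsq : lam * lam = 1) (hmu : mu = -2 * lam) :
    Function.Injective (grayVec p n lam mu) := by
  subst hmu
  intro c d hcd
  funext ⟨i, hi⟩
  have e1 := congrFun hcd ⟨i, by omega⟩
  have e2 := congrFun hcd ⟨n + i, by omega⟩
  have h1 : ¬ n + i < n := by omega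
  simp only [grayVec, hi, h1, dite_true, dite_false, Nat.add_sub_cancel_left] at e1 e2
  generalize c ⟨i, hi⟩ = x at *
  generalize d ⟨i, hi⟩ = y at *
  apply Prod.ext <;> apply mul_left_cancel₀ h2
  · linear_combination e1 + lam * e2 + (-2 * (x.1 - y.1)) * hsq
  · linear_combination -e1 + lam * e2 + (-2 * (x.2 - y.2)) * hsq

/-- The Gray image of a linear code, as a subspace. -/
def grayImage (p n : ℕ) (lam mu : ZMod p)
    (C : Submodule (ZMod p × ZMod p) (Fin n → ZMod p × ZMod p)) :
    Submodule (ZMod p) (Fin (2 * n) → ZMod p) where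
  carrier := grayVec p n lam mu '' (C : Set (Fin n → ZMod p × ZMod p))
  add_mem' := by
    rintro _ _ ⟨c, hc, rfl⟩ ⟨d, hd, rfl⟩
    exact ⟨c + d, C.add_mem hc hd, grayVec_add ..⟩
  zero_mem' := ⟨0, C.zero_mem, by simpa using grayVec_smul p n lam mu 0 0⟩
  smul_mem' := by
    rintro a _ ⟨c, hc, rfl⟩
    exact ⟨ofFHom p a • c, C.smul_mem _ hc, grayVec_smul ..⟩

/-- **Theorem 7.** Let `p` be an odd prime, `R = F_p + vF_p` with
`v² = v`, and `ϑ = 1 - 2v` or `ϑ = -1 + 2v`, written `ϑ = λ + vμ`, with Gray map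
`φ_ϑ : R^n → F_p^{2n}`.  A linear code `C` of length `n` over `R` is `ϑ`-constacyclic
iff `φ_ϑ(C)` is a cyclic code of length `2n` over `F_p` (an `F_p`-subspace of
`F_p^{2n}` closed under the cyclic shift). -/
theorem constacyclic_iff_gray_cyclic (p n : ℕ) (hp : p.Prime) (hodd : Odd p)
    (lam mu : ZMod p) (hϑ : (lam = 1 ∧ mu = -2) ∨ (lam = -1 ∧ mu = 2))
    (C : Submodule (ZMod p × ZMod p) (Fin n → ZMod p × ZMod p)) :
    IsConstacyclic (ofFHom p lam + vR p * ofFHom p mu)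
        (C : Set (Fin n → ZMod p × ZMod p)) ↔
      ∃ D : Submodule (ZMod p) (Fin (2 * n) → ZMod p),
        (D : Set (Fin (2 * n) → ZMod p)) =
            grayVec p n lam mu '' (C : Set (Fin n → ZMod p × ZMod p)) ∧
          IsConstacyclic (1 : ZMod p) (D : Set (Fin (2 * n) → ZMod p)) := by
  have : Fact p.Prime := ⟨hp⟩
  have h2 : (2 : ZMod p) ≠ 0 := by
    apply Ring.two_ne_zero
    rw [ZMod.ringChar_zmod_n]
    rintro rfl
    exact absurd hodd (by decide)
  have hsq : lam * lam = 1 := by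
    rcases hϑ with ⟨rfl, -⟩ | ⟨rfl, -⟩ <;> ring
  have hmu : mu = -2 * lam := by
    rcases hϑ with ⟨rfl, rfl⟩ | ⟨rfl, rfl⟩ <;> ring
  constructor
  · intro hC
    refine ⟨grayImage p n lam mu C, rfl, ?_⟩
    rintro _ ⟨c, hc, rfl⟩
    exact ⟨_, hC c hc, grayVec_shift p n lam mu hsq hmu c⟩
  · rintro ⟨D, hD, hcyc⟩ c hc
    have hmem : shift 1 (grayVec p n lam mu c) ∈ (D : Set (Fin (2 * n) → ZMod p)) :=
      hcyc _ (hD ▸ Set.mem_image_of_mem _ hc)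
    rw [hD, ← grayVec_shift p n lam mu hsq hmu] at hmem
    exact (grayVec_injective p n h2 lam mu hsq hmu).mem_set_image.mp hmem
end

section
/- Let p be an odd prime, R = F_p + vF_p with v^2 = v, θ a unit of R, and C = vC_{1−v} ⊕ (1−v)C_v a θ-constacyclic code of length n over R. Then the dual code satisfies C^⊥ = v·C_{1−v}^⊥ ⊕ (1−v)·C_v^⊥, where C_{1−v}^⊥ and C_v^⊥ are the Euclidean duals of C_{1−v} and C_v in F_p^n. -/
open Polynomial

/-- The dual code `C^⊥ = {u : ∑ᵢ uᵢwᵢ = 0 for all w ∈ C}` with respect to the standard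
Euclidean inner product. -/
def dualCode {m : ℕ} {S : Type*} [CommRing S] (C : Set (Fin m → S)) : Set (Fin m → S) :=
  {u | ∀ w ∈ C, ∑ i, u i * w i = 0}

theorem sum_mul_mix_eq_zero_iff {p n : ℕ} (a b a' b' : Fin n → ZMod p) :
    ∑ i, mix a b i * mix a' b' i = 0 ↔ ∑ i, a i * a' i = 0 ∧ ∑ i, b i * b' i = 0 := by
  simp [mix_apply, Prod.ext_iff, Prod.fst_sum, Prod.snd_sum, and_comm]

theorem mix_mem_dualCode_iff {p n : ℕ} (C : Set (Fin n → ZMod p × ZMod p))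
    (a b : Fin n → ZMod p) :
    mix a b ∈ dualCode C ↔ a ∈ dualCode (C1vSet C) ∧ b ∈ dualCode (CvSet C) := by
  constructor
  · intro h
    exact ⟨fun a' ⟨b', hw⟩ => ((sum_mul_mix_eq_zero_iff a b a' b').1 (h _ hw)).1,
      fun b' ⟨a', hw⟩ => ((sum_mul_mix_eq_zero_iff a b a' b').1 (h _ hw)).2⟩
  · rintro ⟨ha, hb⟩ w hw
    rw [← mix_snd_fst w] at hw ⊢
    exact (sum_mul_mix_eq_zero_iff _ _ _ _).2 ⟨ha _ ⟨_, hw⟩, hb _ ⟨_, hw⟩⟩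

/-- **Theorem 8.** Let `p` be an odd prime, `R = F_p + vF_p` with
`v² = v`, `θ` a unit of `R`, and `C = vC_{1-v} ⊕ (1-v)C_v` a `θ`-constacyclic code of
length `n` over `R`.  Then `C^⊥ = v·C_{1-v}^⊥ ⊕ (1-v)·C_v^⊥`, where `C_{1-v}^⊥` and
`C_v^⊥` are the Euclidean duals of `C_{1-v}` and `C_v` in `F_p^n`. -/
theorem dual_decomposition (p n : ℕ) (hp : p.Prime) (hodd : Odd p)
    (θ : ZMod p × ZMod p) (hθ : IsUnit θ)
    (C : Submodule (ZMod p × ZMod p) (Fin n → ZMod p × ZMod p))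
    (hC : IsConstacyclic θ (C : Set (Fin n → ZMod p × ZMod p))) :
    dualCode (C : Set (Fin n → ZMod p × ZMod p)) =
      {c | ∃ a ∈ dualCode (C1vSet (C : Set (Fin n → ZMod p × ZMod p))),
        ∃ b ∈ dualCode (CvSet (C : Set (Fin n → ZMod p × ZMod p))), c = mix a b} := by
  ext c
  constructor
  · intro hc
    rw [← mix_snd_fst c, mix_mem_dualCode_iff] at hc
    exact ⟨_, hc.1, _, hc.2, (mix_snd_fst c).symm⟩
  · rintro ⟨a, ha, b, hb, rfl⟩
    exact (mix_mem_dualCode_iff _ a b).2 ⟨ha, hb⟩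
end

section
/- Let p be an odd prime, R = F_p + vF_p with v^2 = v, θ = λ + vμ a unit of R, and C a θ-constacyclic code of length n over R with generating set in standard form {v·g_{1−v}(x), (1−v)·g_v(x)}. Write x^n − (λ+μ) = g_{1−v}(x)h_{1−v}(x) and x^n − λ = g_v(x)h_v(x), and let h*_{1−v}(x) = h_{1−v}(0)^{−1}·x^{deg h_{1−v}}·h_{1−v}(1/x) and h*_v(x) = h_v(0)^{−1}·x^{deg h_v}·h_v(1/x) be the monic reciprocal polynomials. Then C^⊥ = ⟨v·h*_{1−v}(x), (1−v)·h*_v(x)⟩ as an ideal of R[x]/⟨x^n − θ^{−1}⟩, and |C^⊥| = p^{deg(g_{1−v}(x)) + deg(g_v(x))}. -/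
open Polynomial

/-- identification of a word `(c_0, …, c_{m-1}) ∈ S^m` with the polynomial
`c_0 + c_1 x + ⋯ + c_{m-1} x^{m-1}`. -/
noncomputable def toPoly {m : ℕ} {S : Type*} [Semiring S] (c : Fin m → S) : S[X] :=
  ∑ i : Fin m, Polynomial.C (c i) * X ^ (i : ℕ)

/-- The monic reciprocal polynomial `h*(x) = h(0)⁻¹ · x^{deg h} · h(1/x)`. -/
noncomputable def recip {p : ℕ} (h : (ZMod p)[X]) : (ZMod p)[X] :=
  Polynomial.C (h.coeff 0)⁻¹ * h.reverse

theorem coeff_toPoly {S : Type*} [Semiring S] {n : ℕ} (c : Fin n → S) (j : ℕ) :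
    (toPoly c).coeff j = if h : j < n then c ⟨j, h⟩ else 0 := by
  simp only [toPoly, finsetSum_coeff, coeff_C_mul, coeff_X_pow, mul_ite, mul_one, mul_zero]
  split_ifs with h
  · rw [Finset.sum_eq_single ⟨j, h⟩]
    · simp
    · intro b _ hb
      exact if_neg fun e => hb (Fin.ext e.symm)
    · simp
  · exact Finset.sum_eq_zero fun i _ => if_neg fun e => h (lt_of_eq_of_lt e i.isLt)

theorem degree_toPoly_lt {S : Type*} [Semiring S] {n : ℕ} (c : Fin n → S) :
    (toPoly c).degree < n := by
  rw [degree_lt_iff_coeff_zero]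
  intro m hm
  rw [coeff_toPoly, dif_neg (by omega)]

theorem toPoly_coeff {S : Type*} [Semiring S] {n : ℕ} {P : S[X]} (hP : P.degree < n) :
    toPoly (fun i : Fin n => P.coeff i) = P := by
  ext j
  rw [coeff_toPoly]
  split_ifs with h
  · rfl
  · exact ((degree_lt_iff_coeff_zero _ _).1 hP j (by omega)).symm

theorem toPoly_injective {S : Type*} [Semiring S] {n : ℕ} :
    Function.Injective (toPoly : (Fin n → S) → S[X]) := by
  intro c d h
  funext i
  have := congrArg (fun P => P.coeff (i : ℕ)) h
  simpa [coeff_toPoly] using this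

theorem map_toPoly {S T : Type*} [Semiring S] [Semiring T] {n : ℕ} (f : S →+* T)
    (c : Fin n → S) : (toPoly c).map f = toPoly fun i => f (c i) := by
  simp [toPoly, Polynomial.map_sum]

/-- The pairing of two words of length `m + 1` is a coefficient of a product of polynomials. -/
theorem coeff_reflect_toPoly_mul {S : Type*} [Semiring S] {m : ℕ} (u w : Fin (m + 1) → S) :
    (reflect m (toPoly u) * toPoly w).coeff m = ∑ i, u i * w i := by
  rw [coeff_mul, Finset.Nat.sum_antidiagonal_eq_sum_range_succ_mk, ← Finset.sum_range_reflect,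
    Finset.sum_range]
  refine Finset.sum_congr rfl fun i _ => ?_
  have hi : (i : ℕ) ≤ m := by omega
  have h1 : m + 1 - 1 - (i : ℕ) = m - i := by omega
  have h2 : m - (m - (i : ℕ)) = i := by omega
  simp only [h1, h2, coeff_reflect, revAt_le (Nat.sub_le m i), coeff_toPoly, i.isLt, dif_pos]

theorem natDegree_toPoly_le {S : Type*} [Semiring S] {m : ℕ} (u : Fin (m + 1) → S) :
    (toPoly u).natDegree ≤ m :=
  natDegree_le_iff_coeff_eq_zero.2 fun N hN => by rw [coeff_toPoly, dif_neg (by omega)]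

section Field

variable {F : Type*} [Field F]

theorem coeff_zero_ne_zero_of_X_pow_sub_C_eq_mul {n : ℕ} (hn : 0 < n) {a : F} (ha : a ≠ 0)
    {g h : F[X]} (hf : X ^ n - C a = g * h) : h.coeff 0 ≠ 0 := by
  intro h0
  have := congrArg (fun P => P.coeff 0) hf
  simp [mul_coeff_zero, h0, coeff_X_pow, hn.ne, ha] at this

theorem natDegree_add_natDegree_of_X_pow_sub_C_eq_mul {n : ℕ} (hn : 0 < n) {a : F}
    {g h : F[X]} (hf : X ^ n - C a = g * h) : g.natDegree + h.natDegree = n := by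
  have hne : g * h ≠ 0 := hf ▸ X_pow_sub_C_ne_zero hn a
  rw [← natDegree_mul (left_ne_zero_of_mul hne) (right_ne_zero_of_mul hne), ← hf,
    natDegree_X_pow_sub_C]

theorem reverse_dvd_X_pow_sub_C_inv {n : ℕ} {a : F} (ha : a ≠ 0)
    {g h : F[X]} (hf : X ^ n - C a = g * h) : h.reverse ∣ X ^ n - C a⁻¹ := by
  have h1 : (X ^ n - C a).reverse = g.reverse * h.reverse := by
    rw [hf, reverse_mul_of_domain]
  have h2 : (X ^ n - C a : F[X]).reverse = 1 - C a * X ^ n := by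
    rw [reverse, natDegree_X_pow_sub_C, reflect_sub, reflect_C, reflect_monomial,
      revAt_le le_rfl, Nat.sub_self, pow_zero]
  have h3 : (X ^ n - C a⁻¹ : F[X]) = C (-a⁻¹) * (1 - C a * X ^ n) := by
    have : C a⁻¹ * C a = (1 : F[X]) := by rw [← C_mul, inv_mul_cancel₀ ha, C_1]
    rw [C_neg]
    linear_combination -(X ^ n) * this
  rw [h3, ← h2, h1]
  exact (dvd_mul_left _ _).mul_left _

/-- Pairing to zero with every multiple of `g` forces divisibility by the reciprocal of the
check polynomial. -/
theorem dvd_reflect_of_forall_pairing_eq_zero {m : ℕ} {a : F} {g h : F[X]}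
    (hf : X ^ (m + 1) - C a = g * h) {u : Fin (m + 1) → F}
    (hu : ∀ w : Fin (m + 1) → F, g ∣ toPoly w → ∑ i, u i * w i = 0) :
    h ∣ reflect m (toPoly u) := by
  have hdeg := natDegree_add_natDegree_of_X_pow_sub_C_eq_mul m.succ_pos hf
  have hne : g * h ≠ 0 := hf ▸ X_pow_sub_C_ne_zero m.succ_pos a
  have hg0 := left_ne_zero_of_mul hne
  set V := reflect m (toPoly u) with hV
  have hVdeg : V.natDegree ≤ m :=
    (natDegree_reflect_le).trans (max_le le_rfl (natDegree_toPoly_le u))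
  have hcoeff : ∀ i, g.natDegree ≤ i → i ≤ m → (V * g).coeff i = 0 := by
    intro i hgi him
    have hd : (g * X ^ (m - i)).degree < ((m + 1 : ℕ) : WithBot ℕ) := by
      rw [degree_mul, degree_X_pow, degree_eq_natDegree hg0]
      norm_cast
      omega
    have := hu (fun j => (g * X ^ (m - i)).coeff j) (by rw [toPoly_coeff hd]; exact dvd_mul_right _ _)
    rw [← coeff_reflect_toPoly_mul, toPoly_coeff hd, ← hV, ← mul_assoc] at this
    have e : m = i + (m - i) := by omega
    rwa [e, add_tsub_cancel_left, coeff_mul_X_pow] at this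
  set A := (V * g) %ₘ X ^ (m + 1) with hA
  set B := (V * g) /ₘ X ^ (m + 1) with hB
  have hAB : A + X ^ (m + 1) * B = V * g := modByMonic_add_div _ _
  have hAdeg : A.degree < (m + 1 : ℕ) := by
    simpa using degree_modByMonic_lt (V * g) (monic_X_pow (m + 1))
  have hVg : (V * g).natDegree ≤ m + g.natDegree :=
    natDegree_mul_le.trans (Nat.add_le_add_right hVdeg _)
  have hr : (A + C a * B).degree < g.natDegree := by
    rw [degree_lt_iff_coeff_zero]
    intro i hi
    have hBi : B.coeff i = 0 := by
      have := congrArg (fun P => P.coeff (i + (m + 1))) hAB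
      simp only [coeff_add, coeff_X_pow_mul] at this
      rw [(degree_lt_iff_coeff_zero _ _).1 hAdeg _ (by omega), zero_add] at this
      rw [this]
      exact coeff_eq_zero_of_natDegree_lt (by omega)
    have hAi : A.coeff i = 0 := by
      by_cases him : i ≤ m
      · have := congrArg (fun P => P.coeff i) hAB
        simp only [coeff_add, coeff_X_pow_mul', hcoeff i hi him] at this
        rwa [if_neg (by omega), add_zero] at this
      · exact (degree_lt_iff_coeff_zero _ _).1 hAdeg _ (by omega)
    simp [hAi, hBi]
  have heq : A + C a * B = g * (V - h * B) := by
    linear_combination hAB - B * hf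
  have hz : A + C a * B = 0 := by
    refine eq_zero_of_dvd_of_degree_lt ⟨_, heq⟩ ?_
    rwa [degree_eq_natDegree hg0]
  rw [hz] at heq
  have := (mul_eq_zero.1 heq.symm).resolve_left hg0
  exact ⟨B, sub_eq_zero.1 this⟩

theorem reverse_dvd_of_forall_pairing_eq_zero {m : ℕ} {a : F} {g h : F[X]}
    (hf : X ^ (m + 1) - C a = g * h) {u : Fin (m + 1) → F}
    (hu : ∀ w : Fin (m + 1) → F, g ∣ toPoly w → ∑ i, u i * w i = 0) :
    h.reverse ∣ toPoly u := by
  obtain ⟨t, ht⟩ := dvd_reflect_of_forall_pairing_eq_zero hf hu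
  have hrr : reflect m (reflect m (toPoly u)) = toPoly u := by
    simp
  rcases eq_or_ne t 0 with rfl | ht0
  · rw [mul_zero] at ht
    rw [← hrr, ht, reflect_zero]
    exact dvd_zero _
  have hne : g * h ≠ 0 := hf ▸ X_pow_sub_C_ne_zero m.succ_pos a
  have hd : h.natDegree + t.natDegree ≤ m := by
    rw [← natDegree_mul (right_ne_zero_of_mul hne) ht0, ← ht]
    exact (natDegree_reflect_le).trans (max_le le_rfl (natDegree_toPoly_le u))
  have e : m = h.natDegree + (m - h.natDegree) := by omega
  rw [← hrr, ht]
  conv_rhs => rw [e]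
  rw [reflect_mul _ _ le_rfl (by omega)]
  exact dvd_mul_right _ _

theorem pairing_eq_zero_of_reverse_dvd {m : ℕ} {a : F} (ha : a ≠ 0) {g h : F[X]}
    (hf : X ^ (m + 1) - C a = g * h) {u w : Fin (m + 1) → F}
    (hu : h.reverse ∣ toPoly u) (hw : g ∣ toPoly w) : ∑ i, u i * w i = 0 := by
  have hdeg := natDegree_add_natDegree_of_X_pow_sub_C_eq_mul m.succ_pos hf
  have hne : g * h ≠ 0 := hf ▸ X_pow_sub_C_ne_zero m.succ_pos a
  have hg0 := left_ne_zero_of_mul hne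
  have hh0 := right_ne_zero_of_mul hne
  have hc := coeff_zero_ne_zero_of_X_pow_sub_C_eq_mul m.succ_pos ha hf
  have hrd : h.reverse.natDegree = h.natDegree := by
    rw [reverse_natDegree, natTrailingDegree_eq_zero.2 (Or.inr hc), tsub_zero]
  have hr0 : h.reverse ≠ 0 := by simpa using hh0
  obtain ⟨s, hs⟩ := hu
  obtain ⟨q, hq⟩ := hw
  rw [← coeff_reflect_toPoly_mul]
  rcases eq_or_ne s 0 with rfl | hs0
  · simp [hs]
  rcases eq_or_ne q 0 with rfl | hq0
  · simp [hq]
  have hsd : h.natDegree + s.natDegree ≤ m := by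
    rw [← hrd, ← natDegree_mul hr0 hs0, ← hs]
    exact natDegree_toPoly_le u
  have hqd : g.natDegree + q.natDegree ≤ m := by
    rw [← natDegree_mul hg0 hq0, ← hq]
    exact natDegree_toPoly_le w
  have hrefl : reflect m (toPoly u) = h * reflect (m - h.natDegree) s := by
    have e : m = h.natDegree + (m - h.natDegree) := by omega
    conv_lhs => rw [hs, e]
    rw [reflect_mul _ _ hrd.le (by omega)]
    congr 1
    ext i
    simp [reverse]
  set r := reflect (m - h.natDegree) s * q with hr
  have hrdeg : r.natDegree < m := by
    have h1 : (reflect (m - h.natDegree) s).natDegree ≤ m - h.natDegree :=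
      (natDegree_reflect_le).trans (max_le le_rfl (by omega))
    have h2 : r.natDegree ≤ _ := natDegree_mul_le
    omega
  have hprod : reflect m (toPoly u) * toPoly w = X ^ (m + 1) * r - C a * r := by
    rw [hrefl, hq, hr]
    linear_combination (-(reflect (m - h.natDegree) s * q)) * hf
  rw [hprod, coeff_sub, coeff_X_pow_mul', if_neg (by omega), coeff_C_mul,
    coeff_eq_zero_of_natDegree_lt hrdeg]
  simp

theorem natCard_dvd_toPoly {n : ℕ} {r : F[X]} (hr : r ≠ 0) (hd : r.natDegree ≤ n) :
    Nat.card {u : Fin n → F // r ∣ toPoly u} = Nat.card F ^ (n - r.natDegree) := by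
  have hdeg : ∀ q : F[X], (r * q).degree < n ↔ q.degree < (n - r.natDegree : ℕ) := by
    intro q
    rcases eq_or_ne q 0 with rfl | hq
    · simp
    rw [← natDegree_lt_iff_degree_lt hq, ← natDegree_lt_iff_degree_lt (mul_ne_zero hr hq),
      natDegree_mul hr hq]
    omega
  have e : degreeLT F (n - r.natDegree) ≃ {u : Fin n → F // r ∣ toPoly u} := by
    refine Equiv.ofBijective
      (fun q => ⟨fun i => (r * q.1).coeff i, ?_⟩) ⟨?_, ?_⟩
    · rw [toPoly_coeff ((hdeg _).2 (mem_degreeLT.1 q.2))]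
      exact dvd_mul_right _ _
    · intro q q' hqq
      have := congrArg toPoly (Subtype.ext_iff.1 hqq)
      dsimp only at this
      rw [toPoly_coeff ((hdeg _).2 (mem_degreeLT.1 q.2)),
        toPoly_coeff ((hdeg _).2 (mem_degreeLT.1 q'.2))] at this
      exact Subtype.ext (mul_left_cancel₀ hr this)
    · rintro ⟨u, q, hq⟩
      have hlt := degree_toPoly_lt u
      rw [hq, hdeg] at hlt
      refine ⟨⟨q, mem_degreeLT.2 hlt⟩, Subtype.ext (toPoly_injective ?_)⟩
      dsimp only
      rw [toPoly_coeff ((hdeg _).2 hlt), hq]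
  rw [← Nat.card_congr e, Nat.card_congr (degreeLTEquiv F _).toEquiv, Nat.card_fun,
    Nat.card_eq_fintype_card (α := Fin _), Fintype.card_fin]

end Field

theorem mk_eq_mk_toPoly {S : Type*} [CommRing S] [Nontrivial S] {n : ℕ} {f : S[X]} (hf : f.Monic)
    (hd : f.natDegree = n) (x : S[X] ⧸ Ideal.span {f}) :
    ∃ c : Fin n → S, x = Ideal.Quotient.mk _ (toPoly c) := by
  obtain ⟨P, rfl⟩ := Ideal.Quotient.mk_surjective x
  have hlt := degree_modByMonic_lt P hf
  rw [degree_eq_natDegree hf.ne_zero, hd] at hlt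
  refine ⟨fun i => (P %ₘ f).coeff i, ?_⟩
  rw [toPoly_coeff hlt, Ideal.Quotient.eq, Ideal.mem_span_singleton]
  exact ⟨P /ₘ f, by linear_combination -(modByMonic_add_div P f)⟩

theorem mk_toPoly_injective {S : Type*} [CommRing S] [Nontrivial S] {n : ℕ} {f : S[X]}
    (hf : f.Monic) (hd : f.natDegree = n) {c d : Fin n → S}
    (h : Ideal.Quotient.mk (Ideal.span {f}) (toPoly c) = Ideal.Quotient.mk _ (toPoly d)) :
    c = d := by
  rw [Ideal.Quotient.eq, Ideal.mem_span_singleton] at h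
  refine toPoly_injective (sub_eq_zero.1 (by_contra fun h0 => hf.not_dvd_of_degree_lt h0 ?_ h))
  rw [degree_eq_natDegree hf.ne_zero, hd]
  exact (degree_sub_le _ _).trans_lt (max_lt (degree_toPoly_lt c) (degree_toPoly_lt d))

theorem prod_polynomial_ext {A B : Type*} [Semiring A] [Semiring B] {P Q : (A × B)[X]}
    (h₁ : P.map (RingHom.fst A B) = Q.map (RingHom.fst A B))
    (h₂ : P.map (RingHom.snd A B) = Q.map (RingHom.snd A B)) : P = Q := by
  ext i
  · simpa using congrArg (fun P => P.coeff i) h₁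
  · simpa using congrArg (fun P => P.coeff i) h₂

/-- Membership in an ideal given by generators in standard form is tested componentwise. -/
theorem mk_mem_span_standard_iff {p n : ℕ} {θ : ZMod p × ZMod p} {g₁ g₂ : (ZMod p)[X]}
    (h₁ : g₁ ∣ X ^ n - C θ.1) (h₂ : g₂ ∣ X ^ n - C θ.2) (P : (ZMod p × ZMod p)[X]) :
    Ideal.Quotient.mk (Ideal.span {X ^ n - C θ}) P ∈ Ideal.span
        {Ideal.Quotient.mk (Ideal.span {X ^ n - C θ}) (C (vR p) * g₂.map (ofFHom p)),
         Ideal.Quotient.mk (Ideal.span {X ^ n - C θ}) ((1 - C (vR p)) * g₁.map (ofFHom p))} ↔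
      g₁ ∣ P.map (RingHom.fst _ _) ∧ g₂ ∣ P.map (RingHom.snd _ _) := by
  have hf : (RingHom.fst (ZMod p) (ZMod p)).comp (ofFHom p) = RingHom.id _ := rfl
  have hs : (RingHom.snd (ZMod p) (ZMod p)).comp (ofFHom p) = RingHom.id _ := rfl
  rw [Ideal.mem_span_pair]
  constructor
  · rintro ⟨A, B, h⟩
    obtain ⟨A, rfl⟩ := Ideal.Quotient.mk_surjective A
    obtain ⟨B, rfl⟩ := Ideal.Quotient.mk_surjective B
    rw [← map_mul, ← map_mul, ← map_add, Eq.comm, Ideal.Quotient.eq,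
      Ideal.mem_span_singleton] at h
    obtain ⟨D, hD⟩ := h
    rw [sub_eq_iff_eq_add] at hD
    rw [hD]
    simp only [Polynomial.map_add, Polynomial.map_mul, Polynomial.map_sub, Polynomial.map_pow,
      map_X, map_C, Polynomial.map_one, Polynomial.map_map, hf, hs, Polynomial.map_id]
    constructor
    · exact dvd_add (h₁.mul_right _) (by simp [vR, dvd_mul_left])
    · exact dvd_add (h₂.mul_right _) (by simp [vR, dvd_mul_left])
  · rintro ⟨⟨a, ha⟩, ⟨b, hb⟩⟩
    refine ⟨Ideal.Quotient.mk _ (b.map (ofFHom p)), Ideal.Quotient.mk _ (a.map (ofFHom p)), ?_⟩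
    rw [← map_mul, ← map_mul, ← map_add]
    congr 1
    apply prod_polynomial_ext
    · simp [Polynomial.map_map, hf, ha, vR, mul_comm]
    · simp [Polynomial.map_map, hs, hb, vR, mul_comm]

theorem mem_dualCode_iff_componentwise {S T : Type*} [CommRing S] [CommRing T] {n : ℕ}
    {C : Set (Fin n → S × T)} {C₁ : Set (Fin n → S)} {C₂ : Set (Fin n → T)}
    (hC : ∀ w, w ∈ C ↔ (fun i => (w i).1) ∈ C₁ ∧ (fun i => (w i).2) ∈ C₂)
    (h₁ : (fun _ => 0) ∈ C₁) (h₂ : (fun _ => 0) ∈ C₂) (u : Fin n → S × T) :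
    u ∈ dualCode C ↔ (fun i => (u i).1) ∈ dualCode C₁ ∧ (fun i => (u i).2) ∈ dualCode C₂ := by
  constructor
  · intro hu
    constructor
    · intro w hw
      simpa [Prod.fst_sum] using congrArg Prod.fst (hu (fun i => (w i, 0)) ((hC _).2 ⟨hw, h₂⟩))
    · intro w hw
      simpa [Prod.snd_sum] using congrArg Prod.snd (hu (fun i => (0, w i)) ((hC _).2 ⟨h₁, hw⟩))
  · rintro ⟨hu₁, hu₂⟩ w hw
    obtain ⟨hw₁, hw₂⟩ := (hC w).1 hw
    apply Prod.ext
    · simpa [Prod.fst_sum] using hu₁ _ hw₁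
    · simpa [Prod.snd_sum] using hu₂ _ hw₂

theorem mem_dualCode_setOf_dvd_iff {F : Type*} [Field F] {n : ℕ} (hn : 0 < n) {a : F}
    (ha : a ≠ 0) {g h : F[X]} (hf : X ^ n - C a = g * h) (u : Fin n → F) :
    u ∈ dualCode {w | g ∣ toPoly w} ↔ h.reverse ∣ toPoly u := by
  obtain ⟨m, rfl⟩ := Nat.exists_eq_succ_of_ne_zero hn.ne'
  exact ⟨fun hu => reverse_dvd_of_forall_pairing_eq_zero hf hu,
    fun hu w hw => pairing_eq_zero_of_reverse_dvd ha hf hu hw⟩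

theorem natCard_reverse_dvd_toPoly {F : Type*} [Field F] {n : ℕ} (hn : 0 < n) {a : F}
    (ha : a ≠ 0) {g h : F[X]} (hf : X ^ n - C a = g * h) :
    Nat.card {u : Fin n → F // h.reverse ∣ toPoly u} = Nat.card F ^ g.natDegree := by
  have hdeg := natDegree_add_natDegree_of_X_pow_sub_C_eq_mul hn hf
  have hc := coeff_zero_ne_zero_of_X_pow_sub_C_eq_mul hn ha hf
  have hrd : h.reverse.natDegree = h.natDegree := by
    rw [reverse_natDegree, natTrailingDegree_eq_zero.2 (Or.inr hc), tsub_zero]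
  have h0 : h.reverse ≠ 0 := by
    rw [Ne, reverse_eq_zero]
    rintro rfl
    exact hc (coeff_zero 0)
  rw [natCard_dvd_toPoly h0 (by omega), hrd]
  congr 1
  omega

theorem recip_dvd_iff {p : ℕ} [Fact p.Prime] {h : (ZMod p)[X]} (h0 : h.coeff 0 ≠ 0)
    (P : (ZMod p)[X]) : recip h ∣ P ↔ h.reverse ∣ P := by
  have : IsUnit (C (h.coeff 0)⁻¹) := isUnit_C.2 (inv_ne_zero h0).isUnit
  exact this.mul_left_dvd

/-- **Theorem 9 (1).** Let `p` be an odd prime, `R = F_p + vF_p` with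
`v² = v`, `θ = λ + vμ` a unit of `R`, and `C` a `θ`-constacyclic code of length `n`
over `R` with generating set in standard form `{v·g_{1-v}(x), (1-v)·g_v(x)}` (under the
identification of `R^n` with `R_n = R[x]/⟨x^n - θ⟩`).  Write
`x^n - (λ+μ) = g_{1-v}(x)h_{1-v}(x)` and `x^n - λ = g_v(x)h_v(x)`.  Then, under the
identification of `R^n` with `R[x]/⟨x^n - θ⁻¹⟩`, the dual code satisfies
`C^⊥ = ⟨v·h*_{1-v}(x), (1-v)·h*_v(x)⟩` and `|C^⊥| = p^{deg g_{1-v} + deg g_v}`. -/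
theorem dual_standard_generators (p n : ℕ) (hp : p.Prime) (hodd : Odd p) (hn : 0 < n)
    (lam mu : ZMod p) (hθ : IsUnit (ofFHom p lam + vR p * ofFHom p mu))
    (C : Submodule (ZMod p × ZMod p) (Fin n → ZMod p × ZMod p))
    (hCc : IsConstacyclic (ofFHom p lam + vR p * ofFHom p mu)
      (C : Set (Fin n → ZMod p × ZMod p)))
    (g1v gv h1v hv : (ZMod p)[X])
    (hg1v_monic : g1v.Monic ∨ g1v = 0) (hgv_monic : gv.Monic ∨ gv = 0)
    (hg1v_dvd : g1v ≠ 0 → g1v ∣ (X : (ZMod p)[X]) ^ n - Polynomial.C (lam + mu))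
    (hgv_dvd : gv ≠ 0 → gv ∣ (X : (ZMod p)[X]) ^ n - Polynomial.C lam)
    (hgen : {x : (ZMod p × ZMod p)[X] ⧸
        Ideal.span {(X : (ZMod p × ZMod p)[X]) ^ n -
          Polynomial.C (ofFHom p lam + vR p * ofFHom p mu)} |
        ∃ c ∈ C, x = Ideal.Quotient.mk _ (toPoly c)} =
      ↑(Ideal.span
        {Ideal.Quotient.mk (Ideal.span {(X : (ZMod p × ZMod p)[X]) ^ n -
            Polynomial.C (ofFHom p lam + vR p * ofFHom p mu)})
          (Polynomial.C (vR p) * g1v.map (ofFHom p)),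
         Ideal.Quotient.mk (Ideal.span {(X : (ZMod p × ZMod p)[X]) ^ n -
            Polynomial.C (ofFHom p lam + vR p * ofFHom p mu)})
          ((1 - Polynomial.C (vR p)) * gv.map (ofFHom p))}))
    (hf1 : (X : (ZMod p)[X]) ^ n - Polynomial.C (lam + mu) = g1v * h1v)
    (hf2 : (X : (ZMod p)[X]) ^ n - Polynomial.C lam = gv * hv) :
    {x : (ZMod p × ZMod p)[X] ⧸
        Ideal.span {(X : (ZMod p × ZMod p)[X]) ^ n -
          Polynomial.C (Ring.inverse (ofFHom p lam + vR p * ofFHom p mu))} |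
        ∃ u ∈ dualCode (C : Set (Fin n → ZMod p × ZMod p)),
          x = Ideal.Quotient.mk _ (toPoly u)} =
      ↑(Ideal.span
        {Ideal.Quotient.mk (Ideal.span {(X : (ZMod p × ZMod p)[X]) ^ n -
            Polynomial.C (Ring.inverse (ofFHom p lam + vR p * ofFHom p mu))})
          (Polynomial.C (vR p) * (recip h1v).map (ofFHom p)),
         Ideal.Quotient.mk (Ideal.span {(X : (ZMod p × ZMod p)[X]) ^ n -
            Polynomial.C (Ring.inverse (ofFHom p lam + vR p * ofFHom p mu))})
          ((1 - Polynomial.C (vR p)) * (recip hv).map (ofFHom p))}) ∧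
    Nat.card ↥(dualCode (C : Set (Fin n → ZMod p × ZMod p))) =
      p ^ (g1v.natDegree + gv.natDegree) := by
  have : Fact p.Prime := ⟨hp⟩
  set θ := ofFHom p lam + vR p * ofFHom p mu with hθdef
  have hθeq : θ = (lam, lam + mu) := by simp [hθdef, ofFHom, vR]
  obtain ⟨hlam, hlm⟩ : lam ≠ 0 ∧ lam + mu ≠ 0 := by
    rw [hθeq, Prod.isUnit_iff] at hθ
    exact ⟨hθ.1.ne_zero, hθ.2.ne_zero⟩
  have hinv : Ring.inverse θ = (lam⁻¹, (lam + mu)⁻¹) := by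
    apply hθ.mul_left_cancel
    rw [Ring.mul_inverse_cancel _ hθ, hθeq]
    ext <;> simp [hlam, hlm]
  have hC : ∀ c, c ∈ (C : Set (Fin n → ZMod p × ZMod p)) ↔
      (fun i => (c i).1) ∈ {w : Fin n → ZMod p | gv ∣ toPoly w} ∧
        (fun i => (c i).2) ∈ {w : Fin n → ZMod p | g1v ∣ toPoly w} := by
    intro c
    have key := mk_mem_span_standard_iff (θ := θ) (n := n) (g₁ := gv) (g₂ := g1v)
      (by rw [hθeq]; exact ⟨hv, hf2⟩) (by rw [hθeq]; exact ⟨h1v, hf1⟩) (toPoly c)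
    rw [map_toPoly, map_toPoly] at key
    refine Iff.trans ?_ key
    rw [← SetLike.mem_coe, ← hgen]
    constructor
    · exact fun hc => ⟨c, hc, rfl⟩
    · rintro ⟨c', hc', h⟩
      rwa [mk_toPoly_injective (monic_X_pow_sub_C θ hn.ne') (natDegree_X_pow_sub_C) h]
  have h1c := coeff_zero_ne_zero_of_X_pow_sub_C_eq_mul hn hlm hf1
  have hvc := coeff_zero_ne_zero_of_X_pow_sub_C_eq_mul hn hlam hf2
  have hdual : ∀ u, u ∈ dualCode (C : Set (Fin n → ZMod p × ZMod p)) ↔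
      hv.reverse ∣ toPoly (fun i => (u i).1) ∧ h1v.reverse ∣ toPoly (fun i => (u i).2) := by
    intro u
    rw [mem_dualCode_iff_componentwise hC (by simp [toPoly]) (by simp [toPoly]),
      mem_dualCode_setOf_dvd_iff hn hlam hf2, mem_dualCode_setOf_dvd_iff hn hlm hf1]
  constructor
  · have hmem := fun u : Fin n → ZMod p × ZMod p =>
      mk_mem_span_standard_iff (θ := Ring.inverse θ) (n := n) (g₁ := recip hv) (g₂ := recip h1v)
        (by rw [hinv, recip_dvd_iff hvc]; exact reverse_dvd_X_pow_sub_C_inv hlam hf2)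
        (by rw [hinv, recip_dvd_iff h1c]; exact reverse_dvd_X_pow_sub_C_inv hlm hf1) (toPoly u)
    simp only [map_toPoly, recip_dvd_iff hvc, recip_dvd_iff h1c, RingHom.coe_fst,
      RingHom.coe_snd, ← hdual] at hmem
    ext x
    constructor
    · rintro ⟨u, hu, rfl⟩
      exact (hmem u).2 hu
    · intro hx
      obtain ⟨u, rfl⟩ := mk_eq_mk_toPoly (monic_X_pow_sub_C (Ring.inverse θ) hn.ne')
        (natDegree_X_pow_sub_C) x
      exact ⟨u, (hmem u).1 hx, rfl⟩
  · have e : ↥(dualCode (C : Set (Fin n → ZMod p × ZMod p))) ≃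
        {u : Fin n → ZMod p // hv.reverse ∣ toPoly u} ×
          {u : Fin n → ZMod p // h1v.reverse ∣ toPoly u} :=
      ((Equiv.arrowProdEquivProdArrow _ _ _).subtypeEquiv hdual).trans
        Equiv.subtypeProdEquivProd
    rw [Nat.card_congr e, Nat.card_prod, natCard_reverse_dvd_toPoly hn hlam hf2,
      natCard_reverse_dvd_toPoly hn hlm hf1, Nat.card_zmod, ← pow_add, add_comm]
end
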